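/- Fix an integer n ≥ 2, x₀ > 0, and κ ∈ (0,1] (κ = 1 - 2μ/σ² with μ ≥ 0 for exponential Brownian motion). Let λ(·) = (1 - n·(·) + (n-1)·(·)^{n/(n-1)})/n, and for c ∈ [0,1) let H_c be the equilibrium cdf H_c(x) = (c + λ(c)·(x/x₀)^κ)^{1/(n-1)} on [0, x̄(c)], x̄(c) = ((1-c)/λ(c))^{1/κ}·x₀, H_c = 1 above x̄(c). Then for any 0 ≤ ĉ < c < 1, the expected maximum of n i.i.d. draws is strictly larger under the higher fee: ∫₀^∞ (1 - H_ĉ(x)ⁿ) dx < ∫₀^∞ (1 - H_c(x)ⁿ) dx. -/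

import Mathlib

open MeasureTheory

/-- The slope coefficient `λ(c) = (1 - n·c + (n-1)·c^{n/(n-1)})/n` of the equilibrium
winning probability in the `n`-player risk-taking contest with submission fee `c`. -/
noncomputable def lamFee (n : ℕ) (c : ℝ) : ℝ :=
  (1 - n * c + ((n : ℝ) - 1) * c ^ ((n : ℝ) / ((n : ℝ) - 1))) / n

/-- Upper bound of the support of the equilibrium distribution for exponential Brownian
motion (scale function `s(x) = x^κ/κ`): `x̄(c) = ((1-c)/λ(c))^{1/κ}·x₀`. -/
noncomputable def expXbar (n : ℕ) (x₀ κ c : ℝ) : ℝ :=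
  ((1 - c) / lamFee n c) ^ (1 / κ) * x₀

/-- Equilibrium cdf for exponential Brownian motion:
`H_c(x) = (c + λ(c)·(x/x₀)^κ)^{1/(n-1)}` on `[0, x̄(c)]`, `1` above, `0` below `0`. -/
noncomputable def expF (n : ℕ) (x₀ κ c x : ℝ) : ℝ :=
  if x < 0 then 0
  else if x ≤ expXbar n x₀ κ c then
    (c + lamFee n c * (x / x₀) ^ κ) ^ ((1 : ℝ) / ((n : ℝ) - 1))
  else 1

theorem lamFee_strictAntiOn {n : ℕ} (hn : 2 ≤ n) :
    StrictAntiOn (lamFee n) (Set.Icc 0 1) := by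
  have hn2 : (2 : ℝ) ≤ n := by exact_mod_cast hn
  have hm : (0 : ℝ) < (n : ℝ) - 1 := by linarith
  have he : 1 ≤ (n : ℝ) / ((n : ℝ) - 1) := by
    rw [le_div_iff₀ hm]; linarith
  have hd : ∀ x : ℝ, HasDerivAt (lamFee n)
      ((-(n : ℝ) + ((n : ℝ) - 1) * ((n : ℝ) / ((n : ℝ) - 1) *
        x ^ ((n : ℝ) / ((n : ℝ) - 1) - 1))) / n) x := by
    intro x
    have h1 := (Real.hasDerivAt_rpow_const (x := x) (Or.inr he)).const_mul ((n : ℝ) - 1)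
    have h2 := ((hasDerivAt_id x).const_mul (n : ℝ)).const_sub 1
    have h3 := (h2.add h1).div_const (n : ℝ)
    rw [mul_one] at h3
    exact h3
  refine strictAntiOn_of_deriv_neg (convex_Icc 0 1)
    (fun x _ => (hd x).continuousAt.continuousWithinAt) ?_
  intro x hx
  rw [interior_Icc] at hx
  rw [(hd x).deriv]
  apply div_neg_of_neg_of_pos _ (by linarith)
  have hx1 : x ^ ((n : ℝ) / ((n : ℝ) - 1) - 1) < 1 := by
    apply Real.rpow_lt_one hx.1.le hx.2
    rw [sub_pos, lt_div_iff₀ hm]; linarith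
  have : ((n : ℝ) - 1) * ((n : ℝ) / ((n : ℝ) - 1) * x ^ ((n : ℝ) / ((n : ℝ) - 1) - 1))
      = n * x ^ ((n : ℝ) / ((n : ℝ) - 1) - 1) := by
    field_simp
  rw [this]
  nlinarith

theorem lamFee_pos {n : ℕ} (hn : 2 ≤ n) {c : ℝ} (h0 : 0 ≤ c) (h1 : c < 1) :
    0 < lamFee n c := by
  have h : lamFee n 1 = 0 := by simp [lamFee]
  rw [← h]
  exact lamFee_strictAntiOn hn ⟨h0, h1.le⟩ ⟨zero_le_one, le_rfl⟩ h1

/-- The equilibrium cdf of the normalized scale value `(X / x₀) ^ κ` on the half-line. -/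
noncomputable def scaleF (n : ℕ) (c y : ℝ) : ℝ :=
  (min 1 (c + lamFee n c * y)) ^ ((1 : ℝ) / ((n : ℝ) - 1))

theorem expF_eq_scaleF {n : ℕ} (hn : 2 ≤ n) {x₀ κ c x : ℝ} (hx₀ : 0 < x₀) (hκ : 0 < κ)
    (h0 : 0 ≤ c) (h1 : c < 1) (hx : 0 ≤ x) :
    expF n x₀ κ c x = scaleF n c ((x / x₀) ^ κ) := by
  have hl := lamFee_pos hn h0 h1
  have hq : 0 ≤ (1 - c) / lamFee n c := div_nonneg (by linarith) hl.le
  have hiff : x ≤ expXbar n x₀ κ c ↔ c + lamFee n c * (x / x₀) ^ κ ≤ 1 := by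
    rw [expXbar, ← div_le_iff₀ hx₀, one_div,
      Real.le_rpow_inv_iff_of_pos (by positivity) hq hκ, le_div_iff₀ hl]
    constructor <;> intro h <;> linarith
  rw [expF, if_neg (not_lt.2 hx), scaleF]
  split_ifs with h
  · rw [min_eq_right (hiff.1 h)]
  · rw [min_eq_left (not_le.1 (mt hiff.2 h)).le, Real.one_rpow]

theorem continuous_scaleF {n : ℕ} (hn : 2 ≤ n) (c : ℝ) : Continuous (scaleF n c) := by
  have hn2 : (2 : ℝ) ≤ n := by exact_mod_cast hn
  have hr : (0 : ℝ) ≤ 1 / ((n : ℝ) - 1) := one_div_nonneg.2 (by linarith)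
  unfold scaleF
  exact Continuous.rpow_const (by fun_prop) fun _ => Or.inr hr

theorem scaleF_nonneg {n : ℕ} (hn : 2 ≤ n) {c y : ℝ} (h0 : 0 ≤ c) (h1 : c < 1)
    (hy : 0 ≤ y) : 0 ≤ scaleF n c y :=
  Real.rpow_nonneg (le_min zero_le_one
    (add_nonneg h0 (mul_nonneg (lamFee_pos hn h0 h1).le hy))) _

theorem scaleF_mono {n : ℕ} (hn : 2 ≤ n) {c y z : ℝ} (h0 : 0 ≤ c) (h1 : c < 1)
    (hy : 0 ≤ y) (hyz : y ≤ z) : scaleF n c y ≤ scaleF n c z := by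
  have hn2 : (2 : ℝ) ≤ n := by exact_mod_cast hn
  have hl := (lamFee_pos hn h0 h1).le
  refine Real.rpow_le_rpow (le_min zero_le_one (add_nonneg h0 (mul_nonneg hl hy))) ?_
    (one_div_nonneg.2 (by linarith))
  gcongr

theorem scaleF_eq_one {n : ℕ} (hn : 2 ≤ n) {c y : ℝ} (h0 : 0 ≤ c) (h1 : c < 1)
    (hy : (1 - c) / lamFee n c ≤ y) : scaleF n c y = 1 := by
  rw [div_le_iff₀ (lamFee_pos hn h0 h1)] at hy
  rw [scaleF, min_eq_left (by linarith), Real.one_rpow]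

/-- The normalized scale value has mean one. -/
theorem integral_one_sub_scaleF {n : ℕ} (hn : 2 ≤ n) {c B : ℝ} (h0 : 0 ≤ c) (h1 : c < 1)
    (hB : (1 - c) / lamFee n c ≤ B) : ∫ y in (0 : ℝ)..B, (1 - scaleF n c y) = 1 := by
  have hn2 : (2 : ℝ) ≤ n := by exact_mod_cast hn
  have hl := lamFee_pos hn h0 h1
  have hr : (0 : ℝ) ≤ 1 / ((n : ℝ) - 1) := one_div_nonneg.2 (by linarith)
  have hq : 0 ≤ (1 - c) / lamFee n c := div_nonneg (by linarith) hl.le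
  have hcont : Continuous fun y => 1 - scaleF n c y :=
    continuous_const.sub (continuous_scaleF hn c)
  rw [← intervalIntegral.integral_add_adjacent_intervals
    (hcont.intervalIntegrable 0 ((1 - c) / lamFee n c)) (hcont.intervalIntegrable _ B)]
  have htail : ∫ y in ((1 - c) / lamFee n c)..B, (1 - scaleF n c y) = 0 := by
    rw [intervalIntegral.integral_congr (g := fun _ => (0 : ℝ))]
    · simp
    · intro y hy
      rw [Set.uIcc_of_le hB] at hy
      simp [scaleF_eq_one hn h0 h1 hy.1]
  have hbody : ∫ y in (0 : ℝ)..((1 - c) / lamFee n c), scaleF n c y =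
      ∫ y in (0 : ℝ)..((1 - c) / lamFee n c),
        (c + lamFee n c * y) ^ ((1 : ℝ) / ((n : ℝ) - 1)) := by
    apply intervalIntegral.integral_congr
    intro y hy
    rw [Set.uIcc_of_le hq] at hy
    have := (le_div_iff₀ hl).1 hy.2
    simp only [scaleF]
    rw [min_eq_right (by linarith)]
  rw [htail, intervalIntegral.integral_sub (by simp)
    ((continuous_scaleF hn c).intervalIntegrable _ _), hbody,
    intervalIntegral.integral_comp_add_mul
      (fun u : ℝ => u ^ ((1 : ℝ) / ((n : ℝ) - 1))) hl.ne',
    integral_rpow (Or.inl (by linarith))]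
  have he : (1 : ℝ) / ((n : ℝ) - 1) + 1 = (n : ℝ) / ((n : ℝ) - 1) := by
    have : (n : ℝ) - 1 ≠ 0 := by linarith
    field_simp
    ring
  have hend : c + lamFee n c * ((1 - c) / lamFee n c) = 1 := by
    field_simp; ring
  have hlam : (n : ℝ) * lamFee n c =
      1 - n * c + ((n : ℝ) - 1) * c ^ ((n : ℝ) / ((n : ℝ) - 1)) := by
    rw [lamFee]; field_simp
  rw [hend, he, mul_zero, add_zero, Real.one_rpow]
  have hm : (n : ℝ) - 1 ≠ 0 := by linarith
  have hn0 : (n : ℝ) ≠ 0 := by linarith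
  simp only [intervalIntegral.integral_const, smul_eq_mul, mul_one, sub_zero, add_zero]
  field_simp
  linarith

/-- The expected maximum as an integral over the normalized scale values. -/
theorem integral_one_sub_expF_pow {n : ℕ} (hn : 2 ≤ n) {x₀ κ c B : ℝ} (hx₀ : 0 < x₀)
    (hκ : 0 < κ) (h0 : 0 ≤ c) (h1 : c < 1) (hB : (1 - c) / lamFee n c ≤ B) :
    ∫ x in Set.Ioi (0 : ℝ), (1 - expF n x₀ κ c x ^ n) =
      x₀ * (κ⁻¹ * ∫ y in (0 : ℝ)..B, y ^ (κ⁻¹ - 1) * (1 - scaleF n c y ^ n)) := by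
  have hq : 0 ≤ (1 - c) / lamFee n c :=
    div_nonneg (by linarith) (lamFee_pos hn h0 h1).le
  have hκ' : 0 < κ⁻¹ := inv_pos.2 hκ
  have e1 : ∫ x in Set.Ioi (0 : ℝ), (1 - expF n x₀ κ c x ^ n) =
      ∫ x in Set.Ioi (0 : ℝ), (1 - scaleF n c ((x₀⁻¹ * x) ^ κ) ^ n) := by
    refine setIntegral_congr_fun measurableSet_Ioi fun x hx => ?_
    rw [expF_eq_scaleF hn hx₀ hκ h0 h1 (le_of_lt hx), div_eq_inv_mul]
  rw [e1, integral_comp_mul_left_Ioi (fun t => 1 - scaleF n c (t ^ κ) ^ n) 0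
    (inv_pos.2 hx₀), mul_zero, inv_inv, smul_eq_mul,
    ← integral_comp_rpow_Ioi (fun t => 1 - scaleF n c (t ^ κ) ^ n) hκ'.ne',
    ← intervalIntegral.integral_const_mul,
    intervalIntegral.integral_of_le (hq.trans hB),
    ← setIntegral_eq_of_subset_of_forall_sdiff_eq_zero measurableSet_Ioi
      (Set.Ioc_subset_Ioi_self : Set.Ioc 0 B ⊆ Set.Ioi 0)]
  · congr 1
    refine setIntegral_congr_fun measurableSet_Ioi fun y hy => ?_
    simp only [smul_eq_mul]
    rw [Real.rpow_inv_rpow (le_of_lt hy) hκ.ne', abs_of_pos hκ', mul_assoc]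
  · intro y hy
    have hy0 : 0 < y := hy.1
    have hyB : B ≤ y := by
      by_contra h
      exact hy.2 ⟨hy0, (not_le.1 h).le⟩
    rw [scaleF_eq_one hn h0 h1 (hB.trans hyB)]
    simp

/-- The normalized equilibrium cdfs for two fees cross exactly once. -/
theorem exists_scaleF_crossing {n : ℕ} (hn : 2 ≤ n) {c c' : ℝ} (hc' : 0 ≤ c')
    (hc'c : c' < c) (hc : c < 1) :
    ∃ z : ℝ, 0 < z ∧ (∀ y, 0 ≤ y → y ≤ z → scaleF n c' y ≤ scaleF n c y) ∧
      ∀ y, z ≤ y → scaleF n c y ≤ scaleF n c' y := by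
  have hn2 : (2 : ℝ) ≤ n := by exact_mod_cast hn
  have hr : (0 : ℝ) ≤ 1 / ((n : ℝ) - 1) := one_div_nonneg.2 (by linarith)
  have h0 := hc'.trans hc'c.le
  have hl := lamFee_pos hn h0 hc
  have hl' := lamFee_pos hn hc' (hc'c.trans hc)
  have hd : 0 < lamFee n c' - lamFee n c := sub_pos.2 <|
    lamFee_strictAntiOn hn ⟨hc', (hc'c.trans hc).le⟩ ⟨h0, hc.le⟩ hc'c
  have hz : 0 < (c - c') / (lamFee n c' - lamFee n c) := div_pos (by linarith) hd
  refine ⟨_, hz, fun y hy hyz => ?_, fun y hzy => ?_⟩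
  · rw [le_div_iff₀ hd] at hyz
    exact Real.rpow_le_rpow (le_min zero_le_one (add_nonneg hc' (mul_nonneg hl'.le hy)))
      (min_le_min_left 1 (by linarith)) hr
  · have hy := hz.le.trans hzy
    rw [div_le_iff₀ hd] at hzy
    exact Real.rpow_le_rpow (le_min zero_le_one (add_nonneg h0 (mul_nonneg hl.le hy)))
      (min_le_min_left 1 (by linarith)) hr

theorem scaleF_zero_lt {n : ℕ} (hn : 2 ≤ n) {c z : ℝ} (h0 : 0 ≤ c) (h1 : c < 1)
    (hz : 0 < z) : scaleF n c 0 < scaleF n c z := by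
  have hn2 : (2 : ℝ) ≤ n := by exact_mod_cast hn
  have hr : (0 : ℝ) < 1 / ((n : ℝ) - 1) := one_div_pos.2 (by linarith)
  have hl := mul_pos (lamFee_pos hn h0 h1) hz
  refine Real.rpow_lt_rpow (le_min zero_le_one (by simpa using h0)) ?_ hr
  rw [mul_zero, add_zero, min_eq_right h1.le]
  exact lt_min h1 (by linarith)

theorem scaleF_zero_lt_scaleF_zero {n : ℕ} (hn : 2 ≤ n) {c c' : ℝ} (hc' : 0 ≤ c')
    (hc'c : c' < c) (hc : c < 1) : scaleF n c' 0 < scaleF n c 0 := by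
  have hn2 : (2 : ℝ) ≤ n := by exact_mod_cast hn
  have hr : (0 : ℝ) < 1 / ((n : ℝ) - 1) := one_div_pos.2 (by linarith)
  simp only [scaleF, mul_zero, add_zero]
  rw [min_eq_right hc.le, min_eq_right (hc'c.trans hc).le]
  exact Real.rpow_lt_rpow hc' hc'c hr

/-- For exponential Brownian motion with `κ ∈ (0,1]` (i.e. `μ ≥ 0`), the expected
performance of the contest winner (the expected maximum of `n` i.i.d. draws from the
equilibrium distribution) is strictly increasing in the submission fee. -/
theorem expF_expected_max_strictMono (n : ℕ) (hn : 2 ≤ n) (x₀ κ : ℝ)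
    (hx₀ : 0 < x₀) (hκ0 : 0 < κ) (hκ1 : κ ≤ 1)
    (c c' : ℝ) (hc' : 0 ≤ c') (hc'c : c' < c) (hc : c < 1) :
    (∫ x in Set.Ioi (0 : ℝ), (1 - (expF n x₀ κ c' x) ^ n)) <
      ∫ x in Set.Ioi (0 : ℝ), (1 - (expF n x₀ κ c x) ^ n) := by
  have hc0 : 0 ≤ c := hc'.trans hc'c.le
  have hlt : c' < 1 := hc'c.trans hc
  set B := max ((1 - c) / lamFee n c) ((1 - c') / lamFee n c')
  have hB : (1 - c) / lamFee n c ≤ B := le_max_left _ _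
  have hB' : (1 - c') / lamFee n c' ≤ B := le_max_right _ _
  have hBpos : 0 < B := (div_pos (by linarith) (lamFee_pos hn hc0 hc)).trans_le hB
  have hκ' : 0 < κ⁻¹ := inv_pos.2 hκ0
  have ha : 0 ≤ κ⁻¹ - 1 := sub_nonneg.2 ((one_le_inv₀ hκ0).2 hκ1)
  rw [integral_one_sub_expF_pow hn hx₀ hκ0 hc' hlt hB',
    integral_one_sub_expF_pow hn hx₀ hκ0 hc0 hc hB]
  refine mul_lt_mul_of_pos_left (mul_lt_mul_of_pos_left ?_ hκ') hx₀
  have hF := continuous_scaleF hn c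
  have hF' := continuous_scaleF hn c'
  have hw : Continuous fun y : ℝ => y ^ (κ⁻¹ - 1) :=
    Real.continuous_rpow_const ha
  obtain ⟨z, hz, hlow, hhigh⟩ := exists_scaleF_crossing hn hc' hc'c hc
  let S : ℝ → ℝ := fun y =>
    ∑ i ∈ Finset.range n, scaleF n c' y ^ i * scaleF n c y ^ (n - 1 - i)
  have hScont : Continuous S :=
    continuous_finsetSum _ fun i _ => (hF'.pow i).mul (hF.pow (n - 1 - i))
  have hSnonneg : ∀ y, 0 ≤ y → 0 ≤ S y := fun y hy =>
    Finset.sum_nonneg fun i _ => mul_nonneg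
      (pow_nonneg (scaleF_nonneg hn hc' hlt hy) _) (pow_nonneg (scaleF_nonneg hn hc0 hc hy) _)
  have hterm : ∀ y u, 0 ≤ y → y ≤ u → ∀ i,
      scaleF n c' y ^ i * scaleF n c y ^ (n - 1 - i) ≤
        scaleF n c' u ^ i * scaleF n c u ^ (n - 1 - i) := fun y u hy hyu i =>
    mul_le_mul
      (pow_le_pow_left₀ (scaleF_nonneg hn hc' hlt hy) (scaleF_mono hn hc' hlt hy hyu) _)
      (pow_le_pow_left₀ (scaleF_nonneg hn hc0 hc hy) (scaleF_mono hn hc0 hc hy hyu) _)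
      (pow_nonneg (scaleF_nonneg hn hc0 hc hy) _)
      (pow_nonneg (scaleF_nonneg hn hc' hlt (hy.trans hyu)) _)
  have hSmono : ∀ y u, 0 ≤ y → y ≤ u → S y ≤ S u := fun y u hy hyu =>
    Finset.sum_le_sum fun i _ => hterm y u hy hyu i
  have hSlt : S 0 < S z := by
    refine Finset.sum_lt_sum (fun i _ => hterm 0 z le_rfl hz.le i)
      ⟨0, Finset.mem_range.2 (by omega), ?_⟩
    simp only [pow_zero, one_mul]
    exact pow_lt_pow_left₀ (scaleF_zero_lt hn hc0 hc hz)
      (scaleF_nonneg hn hc0 hc le_rfl) (by omega)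
  let W : ℝ → ℝ := fun y => S y * y ^ (κ⁻¹ - 1)
  have hWcont : Continuous W := hScont.mul hw
  have hWmono : ∀ y u, 0 ≤ y → y ≤ u → W y ≤ W u := fun y u hy hyu =>
    mul_le_mul (hSmono y u hy hyu) (Real.rpow_le_rpow hy hyu ha) (Real.rpow_nonneg hy _)
      (hSnonneg u (hy.trans hyu))
  have hWlt : W 0 < W z :=
    (mul_le_mul_of_nonneg_left (Real.rpow_le_rpow le_rfl hz.le ha) (hSnonneg 0 le_rfl)).trans_lt
      (mul_lt_mul_of_pos_right hSlt (Real.rpow_pos_of_pos hz _))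
  have key : ∫ y in (0 : ℝ)..B, (scaleF n c' y - scaleF n c y) * W z <
      ∫ y in (0 : ℝ)..B, (scaleF n c' y - scaleF n c y) * W y := by
    refine intervalIntegral.integral_lt_integral_of_continuousOn_of_le_of_exists_lt hBpos
      ((hF'.sub hF).mul continuous_const).continuousOn
      ((hF'.sub hF).mul hWcont).continuousOn (fun y hy => ?_)
      ⟨0, ⟨le_rfl, hBpos.le⟩, mul_lt_mul_of_neg_left hWlt
        (sub_neg.2 (scaleF_zero_lt_scaleF_zero hn hc' hc'c hc))⟩
    rcases le_total y z with h | h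
    · exact mul_le_mul_of_nonpos_left (hWmono y z hy.1.le h)
        (sub_nonpos.2 (hlow y hy.1.le h))
    · exact mul_le_mul_of_nonneg_left (hWmono z y hz.le h) (sub_nonneg.2 (hhigh y h))
  have hmean : ∫ y in (0 : ℝ)..B, (scaleF n c' y - scaleF n c y) * W z = 0 := by
    have h1 := integral_one_sub_scaleF hn hc0 hc hB
    have h2 := integral_one_sub_scaleF hn hc' hlt hB'
    have hintble : ∀ G : ℝ → ℝ, Continuous G →
        IntervalIntegrable (fun y => 1 - G y) volume 0 B := fun G hG =>
      (continuous_const.sub hG).intervalIntegrable 0 B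
    have h3 := intervalIntegral.integral_sub (hintble _ hF) (hintble _ hF')
    rw [h1, h2, sub_self] at h3
    rw [intervalIntegral.integral_mul_const]
    simp only [sub_sub_sub_cancel_left] at h3
    rw [h3, zero_mul]
  rw [hmean] at key
  have hintble : ∀ G : ℝ → ℝ, Continuous G →
      IntervalIntegrable (fun y => y ^ (κ⁻¹ - 1) * (1 - G y ^ n)) volume 0 B := fun G hG =>
    (hw.mul (continuous_const.sub (hG.pow n))).intervalIntegrable 0 B
  rw [← sub_pos, ← intervalIntegral.integral_sub (hintble _ hF) (hintble _ hF')]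
  refine key.trans_eq (intervalIntegral.integral_congr fun y _ => ?_)
  have hgeom : S y * (scaleF n c' y - scaleF n c y) = scaleF n c' y ^ n - scaleF n c y ^ n :=
    geom_sum₂_mul _ _ n
  simp only [W]
  linear_combination y ^ (κ⁻¹ - 1) * hgeom
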